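/- Let V be a real vector space, M ⊆ V a nonempty convex set whose affine span is all of V, and ≽ a preorder on M satisfying SI. Let C = {λ•(x − y) : λ > 0, x, y ∈ M, x ≽ y} ⊆ V be the positive cone of ≽. Then ≽ satisfies MR if and only if C is closed in the weak topology on V. -/

import Mathlib

open Cardinal

variable {V : Type*} [AddCommGroup V] [Module ℝ V]

/-- `u : V → ℝ` is mixture preserving on the convex set `M`. -/
def MixPres (M : Set V) (u : V → ℝ) : Prop :=
  ∀ x ∈ M, ∀ y ∈ M, ∀ α : ℝ, 0 ≤ α → α ≤ 1 →
    u (α • x + (1 - α) • y) = α * u x + (1 - α) * u y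

/-- Axiom MR: existence of a mixture-preserving multi-representation of `r` on `M`. -/
def AxMR (M : Set V) (r : V → V → Prop) : Prop :=
  ∃ U : Set (V → ℝ), U.Nonempty ∧ (∀ u ∈ U, MixPres M u) ∧
    ∀ x ∈ M, ∀ y ∈ M, (r x y ↔ ∀ u ∈ U, u x ≥ u y)

/-- Axiom MC (mixture continuity). -/
def AxMC (M : Set V) (r : V → V → Prop) : Prop :=
  ∀ x ∈ M, ∀ y ∈ M, ∀ z ∈ M,
    (∀ α : ℝ, 0 < α → α ≤ 1 →
      r (α • x + (1 - α) • y) z ∧ ¬ r z (α • x + (1 - α) • y)) →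
    r y z

/-- Axiom SI (strong independence). -/
def AxSI (M : Set V) (r : V → V → Prop) : Prop :=
  ∀ x ∈ M, ∀ y ∈ M, ∀ z ∈ M, ∀ α : ℝ, 0 < α → α < 1 →
    (r x y ↔ r (α • x + (1 - α) • z) (α • y + (1 - α) • z))

/-- Axiom CD (countable domination). -/
def AxCD (M : Set V) (r : V → V → Prop) : Prop :=
  ∃ D : Set (V × V), D.Countable ∧
    (∀ p ∈ D, p.1 ∈ M ∧ p.2 ∈ M ∧ r p.1 p.2) ∧
    ∀ s ∈ M, ∀ t ∈ M, r s t →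
      ∃ p ∈ D, ∃ α : ℝ, 0 < α ∧ α < 1 ∧
        r (α • p.1 + (1 - α) • t) (α • p.2 + (1 - α) • s)

/-- Axiom SD (singleton domination). -/
def AxSD (M : Set V) (r : V → V → Prop) : Prop :=
  ∃ x ∈ M, ∃ y ∈ M, r x y ∧
    ∀ s ∈ M, ∀ t ∈ M, r s t →
      ∃ α : ℝ, 0 < α ∧ α < 1 ∧
        r (α • x + (1 - α) • t) (α • y + (1 - α) • s)

/-- The positive cone of the preorder `r` on `M`. -/
def posCone (M : Set V) (r : V → V → Prop) : Set V :=
  {v | ∃ l : ℝ, 0 < l ∧ ∃ x ∈ M, ∃ y ∈ M, r x y ∧ v = l • (x - y)}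

/-- A set is algebraically closed. -/
def AlgClosed (S : Set V) : Prop :=
  ∀ v w : V, (∀ α : ℝ, 0 < α → α ≤ 1 → (1 - α) • v + α • w ∈ S) → v ∈ S

/-- The weak topology on a real vector space: the coarsest topology making all
linear functionals continuous. -/
def weakTop (W : Type*) [AddCommGroup W] [Module ℝ W] : TopologicalSpace W :=
  ⨅ f : W →ₗ[ℝ] ℝ, TopologicalSpace.induced (⇑f) inferInstance

/-- The linear span of the set of differences of elements of `M`. -/
def diffSpan (M : Set V) : Submodule ℝ V :=
  Submodule.span ℝ {v | ∃ x ∈ M, ∃ y ∈ M, v = x - y}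

/-- `u` is strictly increasing for `r` on `M`. -/
def StrIncr (M : Set V) (r : V → V → Prop) (u : V → ℝ) : Prop :=
  (∀ x ∈ M, ∀ y ∈ M, r x y → u x ≥ u y) ∧
  (∀ x ∈ M, ∀ y ∈ M, r x y → ¬ r y x → u x > u y)

theorem isTopologicalAddGroup_weakTop (W : Type*) [AddCommGroup W] [Module ℝ W] :
    @IsTopologicalAddGroup W (weakTop W) _ :=
  topologicalAddGroup_iInf fun f => topologicalAddGroup_induced f

theorem continuousSMul_weakTop (W : Type*) [AddCommGroup W] [Module ℝ W] :
    @ContinuousSMul ℝ W _ _ (weakTop W) :=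
  continuousSMul_iInf fun f => continuousSMul_induced f

theorem locallyConvexSpace_weakTop (W : Type*) [AddCommGroup W] [Module ℝ W] :
    @LocallyConvexSpace ℝ W _ _ _ _ (weakTop W) :=
  LocallyConvexSpace.iInf fun f => LocallyConvexSpace.induced f

theorem continuous_weakTop {W : Type*} [AddCommGroup W] [Module ℝ W] (f : W →ₗ[ℝ] ℝ) :
    @Continuous W ℝ (weakTop W) _ f :=
  continuous_iInf_dom (i := f) continuous_induced_dom

/-- A point outside a weakly closed convex cone `C` is separated from `C` by a linear functional
that is nonnegative on `C`. -/
theorem exists_linearMap_nonneg_of_notMem {W : Type*} [AddCommGroup W] [Module ℝ W] {C : Set W}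
    (hclosed : @IsClosed W (weakTop W) C) (hzero : (0 : W) ∈ C)
    (hadd : ∀ v ∈ C, ∀ w ∈ C, v + w ∈ C) (hsmul : ∀ c : ℝ, 0 < c → ∀ v ∈ C, c • v ∈ C)
    {p : W} (hp : p ∉ C) : ∃ f : W →ₗ[ℝ] ℝ, (∀ v ∈ C, 0 ≤ f v) ∧ f p < 0 := by
  let : TopologicalSpace W := weakTop W
  have := isTopologicalAddGroup_weakTop W
  have := continuousSMul_weakTop W
  have := locallyConvexSpace_weakTop W
  have hC : Convex ℝ C := convex_iff_forall_pos.2 fun v hv w hw a b ha hb _ =>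
    hadd _ (hsmul a ha v hv) _ (hsmul b hb w hw)
  obtain ⟨f, t, hpt, ht⟩ := geometric_hahn_banach_point_closed hC hclosed hp
  have ht0 : t < 0 := by simpa using ht 0 hzero
  refine ⟨f.toLinearMap, fun v hv => ?_, hpt.trans ht0⟩
  by_contra! hneg
  change f v < 0 at hneg
  have h := ht _ (hsmul (t / f v) (div_pos_of_neg_of_neg ht0 hneg) v hv)
  rw [map_smul, smul_eq_mul, div_mul_cancel₀ _ hneg.ne] at h
  exact h.false

/-- A positive combination of two differences is a positive multiple of the difference of two
mixtures. -/
theorem smul_sub_add_smul_sub (x y x' y' : V) {l l' : ℝ} (hl : 0 < l) (hl' : 0 < l') :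
    l • (x - y) + l' • (x' - y') =
      (l + l') • (((l / (l + l')) • x + (1 - l / (l + l')) • x') -
        ((l / (l + l')) • y + (1 - l / (l + l')) • y')) := by
  match_scalars <;> field_simp <;> ring

theorem mix_eq_mix_of_smul_sub_eq {x y x' y' : V} {l l' : ℝ} (hl : 0 < l) (hl' : 0 < l')
    (h : l • (x - y) = l' • (x' - y')) :
    (l / (l + l')) • x + (1 - l / (l + l')) • y' =
      (l / (l + l')) • y + (1 - l / (l + l')) • x' := by
  have h2 : ((l + l')⁻¹ : ℝ) • (l • (x - y)) = (l + l')⁻¹ • (l' • (x' - y')) := by rw [h]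
  rw [← sub_eq_zero] at h2 ⊢
  rw [← h2]
  match_scalars <;> field_simp <;> ring

theorem div_add_mem_Ioo {l l' : ℝ} (hl : 0 < l) (hl' : 0 < l') :
    l / (l + l') ∈ Set.Ioo (0 : ℝ) 1 :=
  ⟨by positivity, by rw [div_lt_one (by positivity)]; linarith⟩

theorem Convex.mix_mem {M : Set V} (hconv : Convex ℝ M) {x y : V} (hx : x ∈ M) (hy : y ∈ M)
    {α : ℝ} (hα : α ∈ Set.Ioo (0 : ℝ) 1) : α • x + (1 - α) • y ∈ M :=
  hconv hx hy hα.1.le (sub_nonneg.2 hα.2.le) (by ring)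

/-- If the convex set `M` affinely spans `V`, every vector is a positive multiple of a difference of
elements of `M`. -/
theorem exists_eq_smul_sub {M : Set V} (hM : M.Nonempty) (hconv : Convex ℝ M)
    (haff : affineSpan ℝ M = ⊤) (v : V) :
    ∃ l : ℝ, 0 < l ∧ ∃ x ∈ M, ∃ y ∈ M, v = l • (x - y) := by
  have hv : v ∈ vectorSpan ℝ M := by
    rw [← direction_affineSpan, haff, AffineSubspace.direction_top]; trivial
  obtain ⟨z, hz⟩ := hM
  rw [vectorSpan_def] at hv
  induction hv using Submodule.span_induction with
  | mem v hv =>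
    obtain ⟨x, hx, y, hy, rfl⟩ := Set.mem_vsub.1 hv
    exact ⟨1, one_pos, x, hx, y, hy, by simp⟩
  | zero => exact ⟨1, one_pos, z, hz, z, hz, by simp⟩
  | add v w _ _ hv hw =>
    obtain ⟨l, hl, x, hx, y, hy, rfl⟩ := hv
    obtain ⟨l', hl', x', hx', y', hy', rfl⟩ := hw
    have hα := div_add_mem_Ioo hl hl'
    exact ⟨l + l', add_pos hl hl', _, hconv.mix_mem hx hx' hα, _, hconv.mix_mem hy hy' hα,
      smul_sub_add_smul_sub x y x' y' hl hl'⟩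
  | smul c v _ hv =>
    obtain ⟨l, hl, x, hx, y, hy, rfl⟩ := hv
    rcases lt_trichotomy c 0 with hc | rfl | hc
    · exact ⟨-c * l, mul_pos (neg_pos.2 hc) hl, y, hy, x, hx, by module⟩
    · exact ⟨1, one_pos, z, hz, z, hz, by simp⟩
    · exact ⟨c * l, mul_pos hc hl, x, hx, y, hy, by module⟩

/-- A mixture-preserving function on an affinely spanning convex set is, up to a constant, the
restriction of a linear functional. -/
theorem MixPres.exists_linearMap {M : Set V} (hM : M.Nonempty) (hconv : Convex ℝ M)
    (haff : affineSpan ℝ M = ⊤) {u : V → ℝ} (hu : MixPres M u) :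
    ∃ f : V →ₗ[ℝ] ℝ, ∀ x ∈ M, ∀ y ∈ M, f (x - y) = u x - u y := by
  have hmix : ∀ x ∈ M, ∀ y ∈ M, ∀ α ∈ Set.Ioo (0 : ℝ) 1,
      u (α • x + (1 - α) • y) = α * u x + (1 - α) * u y := fun x hx y hy α hα =>
    hu x hx y hy α hα.1.le hα.2.le
  choose l hl x hx y hy hv using exists_eq_smul_sub hM hconv haff
  have hwd : ∀ c : ℝ, 0 < c → ∀ a ∈ M, ∀ b ∈ M, ∀ v : V, v = c • (a - b) →
      l v * (u (x v) - u (y v)) = c * (u a - u b) := by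
    intro c hc a ha b hb v hvc
    have h := congrArg u (mix_eq_mix_of_smul_sub_eq (hl v) hc ((hv v).symm.trans hvc))
    have hα := div_add_mem_Ioo (hl v) hc
    rw [hmix _ (hx v) _ hb _ hα, hmix _ (hy v) _ ha _ hα] at h
    have hpos := add_pos (hl v) hc
    field_simp at h
    linarith
  have hadd : ∀ v w : V, l (v + w) * (u (x (v + w)) - u (y (v + w))) =
      l v * (u (x v) - u (y v)) + l w * (u (x w) - u (y w)) := by
    intro v w
    have hα := div_add_mem_Ioo (hl v) (hl w)
    have hpos := add_pos (hl v) (hl w)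
    rw [hwd (l v + l w) hpos _ (hconv.mix_mem (hx v) (hx w) hα) _
      (hconv.mix_mem (hy v) (hy w) hα) (v + w), hmix _ (hx v) _ (hx w) _ hα,
      hmix _ (hy v) _ (hy w) _ hα]
    · field_simp
      ring
    · rw [← smul_sub_add_smul_sub _ _ _ _ (hl v) (hl w), ← hv, ← hv]
  have hsmul : ∀ (c : ℝ) (v : V), l (c • v) * (u (x (c • v)) - u (y (c • v))) =
      c * (l v * (u (x v) - u (y v))) := by
    intro c v
    have hcv : c • v = c • l v • (x v - y v) := congrArg (c • ·) (hv v)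
    rcases lt_trichotomy c 0 with hc | rfl | hc
    · rw [hwd (-c * l v) (mul_pos (neg_pos.2 hc) (hl v)) _ (hy v) _ (hx v) (c • v)
        (by rw [hcv]; module)]
      ring
    · rw [hwd 1 one_pos _ (hx v) _ (hx v) _ (by simp)]
      ring
    · rw [hwd (c * l v) (mul_pos hc (hl v)) _ (hx v) _ (hy v) (c • v) (by rw [hcv]; module)]
      ring
  exact ⟨{ toFun := fun v => l v * (u (x v) - u (y v)), map_add' := hadd, map_smul' := hsmul },
    fun a ha b hb => (hwd 1 one_pos a ha b hb _ (one_smul ℝ _).symm).trans (one_mul _)⟩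

theorem zero_mem_posCone {M : Set V} {r : V → V → Prop} (hM : M.Nonempty)
    (hrefl : ∀ x ∈ M, r x x) : (0 : V) ∈ posCone M r :=
  let ⟨z, hz⟩ := hM
  ⟨1, one_pos, z, hz, z, hz, hrefl z hz, by simp⟩

theorem smul_mem_posCone {M : Set V} {r : V → V → Prop} {c : ℝ} (hc : 0 < c) {v : V}
    (hv : v ∈ posCone M r) : c • v ∈ posCone M r := by
  obtain ⟨l, hl, x, hx, y, hy, hxy, rfl⟩ := hv
  exact ⟨c * l, mul_pos hc hl, x, hx, y, hy, hxy, smul_smul c l _⟩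

theorem AxSI.add_mem_posCone {M : Set V} {r : V → V → Prop} (hSI : AxSI M r)
    (hconv : Convex ℝ M)
    (htrans : ∀ x ∈ M, ∀ y ∈ M, ∀ z ∈ M, r x y → r y z → r x z) {v w : V}
    (hv : v ∈ posCone M r) (hw : w ∈ posCone M r) : v + w ∈ posCone M r := by
  obtain ⟨l, hl, x, hx, y, hy, hxy, rfl⟩ := hv
  obtain ⟨l', hl', x', hx', y', hy', hxy', rfl⟩ := hw
  have hα := div_add_mem_Ioo hl hl'
  have h1 := (hSI x hx y hy x' hx' _ hα.1 hα.2).1 hxy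
  have h2 := (hSI x' hx' y' hy' y hy (1 - l / (l + l')) (sub_pos.2 hα.2)
    (sub_lt_self 1 hα.1)).1 hxy'
  rw [sub_sub_cancel, add_comm, add_comm _ ((l / (l + l')) • y)] at h2
  exact ⟨l + l', add_pos hl hl', _, hconv.mix_mem hx hx' hα, _, hconv.mix_mem hy hy' hα,
    htrans _ (hconv.mix_mem hx hx' hα) _ (hconv.mix_mem hy hx' hα) _ (hconv.mix_mem hy hy' hα)
      h1 h2, smul_sub_add_smul_sub x y x' y' hl hl'⟩

theorem AxSI.sub_mem_posCone_iff {M : Set V} {r : V → V → Prop} (hSI : AxSI M r) {x y : V}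
    (hx : x ∈ M) (hy : y ∈ M) : x - y ∈ posCone M r ↔ r x y := by
  refine ⟨?_, fun h => ⟨1, one_pos, x, hx, y, hy, h, (one_smul ℝ _).symm⟩⟩
  rintro ⟨l, hl, x', hx', y', hy', hxy', h⟩
  have hα := div_add_mem_Ioo one_pos hl
  have h1 := (hSI x' hx' y' hy' y hy (1 - 1 / (1 + l)) (sub_pos.2 hα.2)
    (sub_lt_self 1 hα.1)).1 hxy'
  rw [sub_sub_cancel, add_comm, add_comm _ ((1 / (1 + l)) • y),
    ← mix_eq_mix_of_smul_sub_eq one_pos hl ((one_smul ℝ _).trans h)] at h1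
  exact (hSI x hx y hy y' hy' _ hα.1 hα.2).2 h1

theorem stmt_8 (M : Set V) (hM : M.Nonempty) (hconv : Convex ℝ M)
    (haff : affineSpan ℝ M = ⊤)
    (r : V → V → Prop) (hrefl : ∀ x ∈ M, r x x)
    (htrans : ∀ x ∈ M, ∀ y ∈ M, ∀ z ∈ M, r x y → r y z → r x z)
    (hSI : AxSI M r) :
    AxMR M r ↔ @IsClosed V (weakTop V) (posCone M r) := by
  constructor
  · rintro ⟨U, -, hmix, hrep⟩
    choose f hf using fun u : U => (hmix u u.2).exists_linearMap hM hconv haff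
    have hC : posCone M r = ⋂ u : U, f u ⁻¹' Set.Ici 0 := by
      ext v
      obtain ⟨l, hl, x, hx, y, hy, rfl⟩ := exists_eq_smul_sub hM hconv haff v
      have hcone : l • (x - y) ∈ posCone M r ↔ x - y ∈ posCone M r :=
        ⟨fun h => by simpa [smul_smul, hl.ne'] using smul_mem_posCone (inv_pos.2 hl) h,
          smul_mem_posCone hl⟩
      rw [hcone, hSI.sub_mem_posCone_iff hx hy, hrep x hx y hy]
      simp only [Set.mem_iInter, Set.mem_preimage, Set.mem_Ici, map_smul, smul_eq_mul,
        mul_nonneg_iff_of_pos_left hl, hf _ x hx y hy, sub_nonneg, Subtype.forall, ge_iff_le]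
    let : TopologicalSpace V := weakTop V
    rw [hC]
    exact isClosed_iInter fun u => isClosed_Ici.preimage (continuous_weakTop (f u))
  · intro hclosed
    refine ⟨{u | ∃ f : V →ₗ[ℝ] ℝ, (∀ v ∈ posCone M r, 0 ≤ f v) ∧ ⇑f = u},
      ⟨_, 0, by simp, rfl⟩, ?_, fun x hx y hy => ⟨?_, fun h => ?_⟩⟩
    · rintro _ ⟨f, -, rfl⟩ x _ y _ α _ _
      simp
    · rintro hxy _ ⟨f, hf, rfl⟩
      simpa using hf _ ((hSI.sub_mem_posCone_iff hx hy).2 hxy)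
    · by_contra hxy
      obtain ⟨f, hf, hlt⟩ := exists_linearMap_nonneg_of_notMem hclosed
        (zero_mem_posCone hM hrefl) (fun v hv w hw => hSI.add_mem_posCone hconv htrans hv hw)
        (fun c hc v hv => smul_mem_posCone hc hv) (mt (hSI.sub_mem_posCone_iff hx hy).1 hxy)
      rw [map_sub, sub_neg] at hlt
      exact (h f ⟨f, hf, rfl⟩).not_gt hlt
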